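/- arXiv:1103.0459 — 8 statements merged into one kernel-verified Lean document; each statement's English description precedes it below -/
import Mathlib

section
/- Let A, B, C be an affinely independent triple of points in EuclideanSpace ℝ (Fin 2), let a = dist B C, b = dist C A, c = dist A B, and let P be the point with barycentric coordinates (α, β, γ) with respect to (A, B, C), i.e. α + β + γ = 1 and P = α • A + β • B + γ • C (affine combination). Then the orthogonal projection A₁ of P onto the line through B and C is the affine combination A₁ = y • B + z • C where y = α·(a² + b² − c²)/(2a²) + β and z = α·(a² − b² + c²)/(2a²) + γ. -/
open EuclideanGeometry

/-- The orthogonal projection of `r` onto the line through `p` and `q`, in terms of the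
inner product of `r -ᵥ p` and `q -ᵥ p`. -/
theorem coe_orthogonalProjection_affineSpan_pair {V P : Type*} [NormedAddCommGroup V]
    [InnerProductSpace ℝ V] [MetricSpace P] [NormedAddTorsor V P] (p q r : P) :
    (EuclideanGeometry.orthogonalProjection (affineSpan ℝ {p, q}) r : P) =
      AffineMap.lineMap p q (inner ℝ (r -ᵥ p) (q -ᵥ p) / ‖q -ᵥ p‖ ^ 2) := by
  rw [coe_orthogonalProjection_eq_iff_mem]
  refine ⟨AffineMap.lineMap_mem_affineSpan_pair _ _ _, ?_⟩
  rw [direction_affineSpan, vectorSpan_pair_rev, Submodule.mem_orthogonal_singleton_iff_inner_left,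
    AffineMap.lineMap_apply, vsub_vadd_eq_vsub_sub, inner_sub_left, real_inner_smul_left,
    real_inner_self_eq_norm_sq]
  by_cases h : q -ᵥ p = 0
  · simp [h]
  · rw [div_mul_cancel₀ _ (by simpa using h), sub_self]

theorem pedal_projection_onto_BC
    (A B C P : EuclideanSpace ℝ (Fin 2))
    (hABC : AffineIndependent ℝ ![A, B, C])
    (a b c α β γ : ℝ)
    (ha : a = dist B C) (hb : b = dist C A) (hc : c = dist A B)
    (hsum : α + β + γ = 1)
    (hP : P = α • A + β • B + γ • C) :
    (EuclideanGeometry.orthogonalProjection (affineSpan ℝ {B, C}) P :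
        EuclideanSpace ℝ (Fin 2)) =
      (α * (a ^ 2 + b ^ 2 - c ^ 2) / (2 * a ^ 2) + β) • B +
        (α * (a ^ 2 - b ^ 2 + c ^ 2) / (2 * a ^ 2) + γ) • C := by
  have hBC : B ≠ C := by simpa using hABC.injective.ne (show (1 : Fin 3) ≠ 2 by decide)
  have ha0 : a ≠ 0 := ha ▸ dist_ne_zero.2 hBC
  have hu : ‖C - B‖ = a := by rw [ha, dist_comm, dist_eq_norm]
  have hv : ‖A - B‖ = c := by rw [hc, dist_eq_norm]
  have hw : b ^ 2 = a ^ 2 - 2 * inner ℝ (C - B) (A - B) + c ^ 2 := by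
    rw [hb, dist_eq_norm, ← sub_sub_sub_cancel_right C A B, norm_sub_sq_real, hu, hv]
  have hβ : β = 1 - α - γ := by linarith
  have hPB : P - B = α • (A - B) + γ • (C - B) := by
    rw [hP, hβ]
    module
  rw [coe_orthogonalProjection_affineSpan_pair, vsub_eq_sub, vsub_eq_sub, hPB, inner_add_left,
    real_inner_smul_left, real_inner_smul_left, real_inner_self_eq_norm_sq, hu,
    real_inner_comm, AffineMap.lineMap_apply_module]
  congr 2
  · rw [hβ, hw]
    field_simp
    ring
  · rw [hw]
    field_simp
    ring
end

section
/- Let A, B, C be an affinely independent triple of points in EuclideanSpace ℝ (Fin 2), let a = dist B C, b = dist C A, c = dist A B, and let P be the point with barycentric coordinates (α, β, γ) with respect to (A, B, C), i.e. α + β + γ = 1 and P = α • A + β • B + γ • C (affine combination). Then the orthogonal projection B₁ of P onto the line through C and A is the affine combination B₁ = x • A + z • C where x = β·(a² + b² − c²)/(2b²) + α and z = β·(−a² + b² + c²)/(2b²) + γ. -/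
open EuclideanGeometry

theorem pedal_projection_onto_CA
    (A B C P : EuclideanSpace ℝ (Fin 2))
    (hABC : AffineIndependent ℝ ![A, B, C])
    (a b c α β γ : ℝ)
    (ha : a = dist B C) (hb : b = dist C A) (hc : c = dist A B)
    (hsum : α + β + γ = 1)
    (hP : P = α • A + β • B + γ • C) :
    (EuclideanGeometry.orthogonalProjection (affineSpan ℝ {C, A}) P :
        EuclideanSpace ℝ (Fin 2)) =
      (β * (a ^ 2 + b ^ 2 - c ^ 2) / (2 * b ^ 2) + α) • A +
        (β * (-a ^ 2 + b ^ 2 + c ^ 2) / (2 * b ^ 2) + γ) • C := by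
  have hCA : C ≠ A := fun h ↦ by simpa using hABC.injective (a₁ := 2) (a₂ := 0) h
  have hb0 : b ≠ 0 := hb ▸ dist_ne_zero.2 hCA
  rw [coe_orthogonalProjection_eq_iff_mem]
  constructor
  · convert! AffineMap.lineMap_mem_affineSpan_pair
      (β * (a ^ 2 + b ^ 2 - c ^ 2) / (2 * b ^ 2) + α) C A using 1
    have hx : β * (-a ^ 2 + b ^ 2 + c ^ 2) / (2 * b ^ 2) + γ =
        1 - (β * (a ^ 2 + b ^ 2 - c ^ 2) / (2 * b ^ 2) + α) := by
      field_simp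
      linear_combination 2 * b ^ 2 * hsum
    rw [hx, AffineMap.lineMap_apply_module]
    abel
  · have ha2 : a ^ 2 = inner ℝ (B - C) (B - C) := by
      rw [ha, dist_eq_norm, real_inner_self_eq_norm_sq]
    have hb2 : b ^ 2 = inner ℝ (A - C) (A - C) := by
      rw [hb, dist_comm, dist_eq_norm, real_inner_self_eq_norm_sq]
    have hc2 : c ^ 2 = b ^ 2 - 2 * inner ℝ (B - C) (A - C) + a ^ 2 := by
      rw [hc, dist_eq_norm, ← sub_sub_sub_cancel_right A B C, norm_sub_sq_real, ha2, hb2,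
        real_inner_self_eq_norm_sq, real_inner_self_eq_norm_sq, real_inner_comm]
    have hPQ : P - ((β * (a ^ 2 + b ^ 2 - c ^ 2) / (2 * b ^ 2) + α) • A +
          (β * (-a ^ 2 + b ^ 2 + c ^ 2) / (2 * b ^ 2) + γ) • C) =
        β • ((B - C) - ((a ^ 2 + b ^ 2 - c ^ 2) / (2 * b ^ 2)) • (A - C)) := by
      rw [hP]
      match_scalars <;> field_simp <;> ring
    rw [direction_affineSpan, vectorSpan_pair_rev, Submodule.mem_orthogonal_singleton_iff_inner_left,
      vsub_eq_sub, vsub_eq_sub, hPQ, inner_smul_left, inner_sub_left, inner_smul_left, ← hb2, hc2]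
    simp only [conj_trivial]
    field_simp
    ring
end

section
/- Let A, B, C be an affinely independent triple of points in EuclideanSpace ℝ (Fin 2), let a = dist B C, b = dist C A, c = dist A B, and let P be the point with barycentric coordinates (α, β, γ) with respect to (A, B, C), i.e. α + β + γ = 1 and P = α • A + β • B + γ • C (affine combination). Then the orthogonal projection C₁ of P onto the line through A and B is the affine combination C₁ = x • A + y • B where x = γ·(a² − b² + c²)/(2c²) + α and y = γ·(−a² + b² + c²)/(2c²) + β. -/
open EuclideanGeometry

theorem pedal_projection_onto_AB
    (A B C P : EuclideanSpace ℝ (Fin 2))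
    (hABC : AffineIndependent ℝ ![A, B, C])
    (a b c α β γ : ℝ)
    (ha : a = dist B C) (hb : b = dist C A) (hc : c = dist A B)
    (hsum : α + β + γ = 1)
    (hP : P = α • A + β • B + γ • C) :
    (EuclideanGeometry.orthogonalProjection (affineSpan ℝ {A, B}) P :
        EuclideanSpace ℝ (Fin 2)) =
      (γ * (a ^ 2 - b ^ 2 + c ^ 2) / (2 * c ^ 2) + α) • A +
        (γ * (-a ^ 2 + b ^ 2 + c ^ 2) / (2 * c ^ 2) + β) • B := by
  have hAB : A ≠ B := hABC.injective.ne (show (0 : Fin 3) ≠ 1 by decide)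
  have hc0 : c ≠ 0 := hc ▸ dist_ne_zero.mpr hAB
  set t : ℝ := (-a ^ 2 + b ^ 2 + c ^ 2) / (2 * c ^ 2) with ht
  have hy : γ * (-a ^ 2 + b ^ 2 + c ^ 2) / (2 * c ^ 2) + β = γ * t + β := by
    rw [ht, mul_div_assoc]
  have hx : γ * (a ^ 2 - b ^ 2 + c ^ 2) / (2 * c ^ 2) + α = 1 - (γ * t + β) := by
    rw [← hsum, ht]
    field_simp
    ring
  have hinner : inner ℝ (B - A) (C - A) = t * c ^ 2 := by
    have ha' : a = ‖(B - A) - (C - A)‖ := by rw [ha, dist_eq_norm, sub_sub_sub_cancel_right]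
    have hb' : b = ‖C - A‖ := by rw [hb, dist_eq_norm]
    have hc' : c = ‖B - A‖ := by rw [hc, dist_comm, dist_eq_norm]
    have h := norm_sub_sq_real (B - A) (C - A)
    rw [← ha', ← hb', ← hc'] at h
    rw [ht]
    field_simp
    linarith
  rw [hx, hy, coe_orthogonalProjection_eq_iff_mem]
  constructor
  · have h := AffineMap.lineMap_mem_affineSpan_pair (γ * t + β) A B
    rwa [AffineMap.lineMap_apply_module] at h
  · rw [direction_affineSpan, vectorSpan_pair_rev,
      Submodule.mem_orthogonal_singleton_iff_inner_right, vsub_eq_sub, vsub_eq_sub]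
    have hPQ : P - ((1 - (γ * t + β)) • A + (γ * t + β) • B) =
        γ • ((C - A) - t • (B - A)) := by
      rw [hP, ← hsum]
      module
    rw [hPQ, inner_smul_right, inner_sub_right, inner_smul_right, hinner,
      real_inner_self_eq_norm_sq, ← dist_eq_norm, dist_comm, ← hc, sub_self, mul_zero]
end

section
/- Let A, B, C be an affinely independent triple of points in EuclideanSpace ℝ (Fin 2), let a = dist B C, b = dist C A, c = dist A B, set cosB = (c² + a² − b²)/(2ca) and cosC = (a² + b² − c²)/(2ab), and let P be the point with barycentric coordinates (α, β, γ) with respect to (A, B, C) (so α + β + γ = 1 and P = α • A + β • B + γ • C). Let A₁ be the orthogonal projection of P onto the line through B and C. If α·b·cosC + β·a ≠ 0, then (B − A₁) = −((α·c·cosB + γ·a)/(α·b·cosC + β·a)) • (C − A₁) as vectors in EuclideanSpace ℝ (Fin 2). -/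
open EuclideanGeometry

/-- The inner product of two sides of a triangle at `B`, by the law of cosines. -/
theorem two_mul_inner_sub_sub_eq_dist_sq {V : Type*} [NormedAddCommGroup V]
    [InnerProductSpace ℝ V] (A B C : V) :
    2 * inner ℝ (A - B) (C - B) = dist A B ^ 2 + dist B C ^ 2 - dist C A ^ 2 := by
  have h := norm_sub_sq_real (A - B) (C - B)
  rw [sub_sub_sub_cancel_right] at h
  rw [dist_eq_norm A B, dist_comm B C, dist_eq_norm C B, dist_comm C A, dist_eq_norm A C]
  linarith

/-- The orthogonal projection of `P` onto the line `BC` is the point `B + t (C - B)`, where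
`t |BC|² = ⟪P - B, C - B⟫`. -/
theorem exists_orthogonalProjection_affineSpan_pair_eq {V : Type*} [NormedAddCommGroup V]
    [InnerProductSpace ℝ V] (B C P : V) :
    ∃ t : ℝ, (orthogonalProjection (affineSpan ℝ {B, C}) P : V) = B + t • (C - B) ∧
      t * dist B C ^ 2 = inner ℝ (P - B) (C - B) := by
  obtain ⟨t, ht⟩ := mem_affineSpan_pair_iff_exists_lineMap_eq.1
    (orthogonalProjection_mem (s := affineSpan ℝ {B, C}) P)
  rw [AffineMap.lineMap_apply_module'] at ht
  refine ⟨t, by rw [← ht, add_comm], ?_⟩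
  have hdir : C - B ∈ (affineSpan ℝ {B, C}).direction :=
    AffineSubspace.vsub_mem_direction (right_mem_affineSpan_pair ℝ B C)
      (left_mem_affineSpan_pair ℝ B C)
  have horth := Submodule.inner_left_of_mem_orthogonal hdir
    (vsub_orthogonalProjection_mem_direction_orthogonal (affineSpan ℝ {B, C}) P)
  rw [← ht, vsub_eq_sub, add_comm, ← sub_sub, inner_sub_left, real_inner_smul_left,
    real_inner_self_eq_norm_sq] at horth
  rw [dist_comm, dist_eq_norm]
  linarith

theorem pedal_ratio_on_BC
    (A B C P : EuclideanSpace ℝ (Fin 2))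
    (hABC : AffineIndependent ℝ ![A, B, C])
    (a b c cosB cosC α β γ : ℝ)
    (ha : a = dist B C) (hb : b = dist C A) (hc : c = dist A B)
    (hcosB : cosB = (c ^ 2 + a ^ 2 - b ^ 2) / (2 * c * a))
    (hcosC : cosC = (a ^ 2 + b ^ 2 - c ^ 2) / (2 * a * b))
    (hsum : α + β + γ = 1)
    (hP : P = α • A + β • B + γ • C)
    (A₁ : EuclideanSpace ℝ (Fin 2))
    (hA₁ : A₁ = (EuclideanGeometry.orthogonalProjection (affineSpan ℝ {B, C}) P :
        EuclideanSpace ℝ (Fin 2)))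
    (hden : α * b * cosC + β * a ≠ 0) :
    B - A₁ = (-((α * c * cosB + γ * a) / (α * b * cosC + β * a))) • (C - A₁) := by
  have hAB : A ≠ B := by simpa using hABC.injective.ne (show (0 : Fin 3) ≠ 1 by decide)
  have hBC : B ≠ C := by simpa using hABC.injective.ne (show (1 : Fin 3) ≠ 2 by decide)
  have hCA : C ≠ A := by simpa using hABC.injective.ne (show (2 : Fin 3) ≠ 0 by decide)
  have ha0 : a ≠ 0 := ha ▸ dist_ne_zero.2 hBC
  have hb0 : b ≠ 0 := hb ▸ dist_ne_zero.2 hCA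
  have hc0 : c ≠ 0 := hc ▸ dist_ne_zero.2 hAB
  have hinner := two_mul_inner_sub_sub_eq_dist_sq A B C
  obtain ⟨t, hA₁t, ht⟩ := exists_orthogonalProjection_affineSpan_pair_eq B C P
  rw [← hA₁] at hA₁t
  have hPB : P - B = α • (A - B) + γ • (C - B) := by
    obtain rfl : β = 1 - α - γ := by linarith
    rw [hP]
    module
  have hself : inner ℝ (C - B) (C - B) = a ^ 2 := by
    rw [real_inner_self_eq_norm_sq, ← dist_eq_norm, dist_comm, ha]
  rw [hPB, inner_add_left, real_inner_smul_left, real_inner_smul_left, hself, ← ha] at ht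
  rw [← ha, ← hb, ← hc] at hinner
  have hnum : α * c * cosB + γ * a = t * a := by
    rw [hcosB]
    field_simp
    linear_combination -2 * ht - α * hinner
  have hden' : α * b * cosC + β * a = (1 - t) * a := by
    rw [hcosC]
    field_simp
    linear_combination 2 * ht + α * hinner + 2 * a ^ 2 * hsum
  have ht1 : 1 - t ≠ 0 := left_ne_zero_of_mul (hden' ▸ hden)
  rw [hnum, hden', mul_div_mul_right _ _ ha0, hA₁t,
    show C - (B + t • (C - B)) = (1 - t) • (C - B) by module, smul_smul, neg_mul,
    div_mul_cancel₀ _ ht1]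
  module
end

section
/- (Smarandache–Pătrașcu theorem, algebraic form.) Let a, b, c be positive real numbers, set cosA = (b² + c² − a²)/(2bc), cosB = (c² + a² − b²)/(2ca), cosC = (a² + b² − c²)/(2ab), and for reals x, y, z define F(x, y, z) = a·x·(b²z² − c²y²)·(cosA − cosB·cosC) + b·y·(c²x² − a²z²)·(cosB − cosA·cosC) + c·z·(a²y² − b²x²)·(cosC − cosA·cosB). Let α, β, γ, α', β', γ' be real numbers with α·β·γ ≠ 0 and α·α'/a² = β·β'/b² = γ·γ'/c² (the isogonal conjugacy relation). If F(α, β, γ) = 0, then F(α', β', γ') = 0. -/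
theorem smarandache_patrascu_isogonal
    (a b c : ℝ) (ha : 0 < a) (hb : 0 < b) (hc : 0 < c)
    (cosA cosB cosC : ℝ)
    (hcosA : cosA = (b ^ 2 + c ^ 2 - a ^ 2) / (2 * b * c))
    (hcosB : cosB = (c ^ 2 + a ^ 2 - b ^ 2) / (2 * c * a))
    (hcosC : cosC = (a ^ 2 + b ^ 2 - c ^ 2) / (2 * a * b))
    (F : ℝ → ℝ → ℝ → ℝ)
    (hF : ∀ x y z : ℝ, F x y z =
      a * x * (b ^ 2 * z ^ 2 - c ^ 2 * y ^ 2) * (cosA - cosB * cosC) +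
        b * y * (c ^ 2 * x ^ 2 - a ^ 2 * z ^ 2) * (cosB - cosA * cosC) +
        c * z * (a ^ 2 * y ^ 2 - b ^ 2 * x ^ 2) * (cosC - cosA * cosB))
    (α β γ α' β' γ' : ℝ)
    (hαβγ : α * β * γ ≠ 0)
    (hiso1 : α * α' / a ^ 2 = β * β' / b ^ 2)
    (hiso2 : β * β' / b ^ 2 = γ * γ' / c ^ 2)
    (hP : F α β γ = 0) :
    F α' β' γ' = 0 := by
  have hα : α ≠ 0 := by rintro rfl; simp at hαβγ
  have hβ : β ≠ 0 := by rintro rfl; simp at hαβγ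
  have hγ : γ ≠ 0 := by rintro rfl; simp at hαβγ
  obtain ⟨k, hk⟩ : ∃ k, k = γ * γ' / c ^ 2 := ⟨_, rfl⟩
  have hα' : α' = k * a ^ 2 / α := by
    rw [hk, ← hiso2, ← hiso1]; field_simp
  have hβ' : β' = k * b ^ 2 / β := by
    rw [hk, ← hiso2]; field_simp
  have hγ' : γ' = k * c ^ 2 / γ := by
    rw [hk]; field_simp
  have key : F α' β' γ' = -(k ^ 3 * (a * b * c) ^ 2 / (α * β * γ) ^ 2) * F α β γ := by
    clear hcosA hcosB hcosC hk hiso1 hiso2 hP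
    rw [hF, hF, hα', hβ', hγ']
    field_simp
    ring
  rw [key, hP, mul_zero]
end

section
/- Let a, b, c be positive real numbers satisfying the strict triangle inequalities a < b + c, b < c + a, c < a + b, set cosA = (b² + c² − a²)/(2bc), cosB = (c² + a² − b²)/(2ca), cosC = (a² + b² − c²)/(2ab), and define F(x, y, z) = a·x·(b²z² − c²y²)·(cosA − cosB·cosC) + b·y·(c²x² − a²z²)·(cosB − cosA·cosC) + c·z·(a²y² − b²x²)·(cosC − cosA·cosB). Then the barycentric coordinates of the circumcenter satisfy the locus equation: F(a²·(b² + c² − a²), b²·(c² + a² − b²), c²·(a² + b² − c²)) = 0. -/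
theorem circumcenter_mem_locus
    (a b c : ℝ) (ha : 0 < a) (hb : 0 < b) (hc : 0 < c)
    (hab : a < b + c) (hbc : b < c + a) (hca : c < a + b)
    (cosA cosB cosC : ℝ)
    (hcosA : cosA = (b ^ 2 + c ^ 2 - a ^ 2) / (2 * b * c))
    (hcosB : cosB = (c ^ 2 + a ^ 2 - b ^ 2) / (2 * c * a))
    (hcosC : cosC = (a ^ 2 + b ^ 2 - c ^ 2) / (2 * a * b))
    (F : ℝ → ℝ → ℝ → ℝ)
    (hF : ∀ x y z : ℝ, F x y z =
      a * x * (b ^ 2 * z ^ 2 - c ^ 2 * y ^ 2) * (cosA - cosB * cosC) +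
        b * y * (c ^ 2 * x ^ 2 - a ^ 2 * z ^ 2) * (cosB - cosA * cosC) +
        c * z * (a ^ 2 * y ^ 2 - b ^ 2 * x ^ 2) * (cosC - cosA * cosB)) :
    F (a ^ 2 * (b ^ 2 + c ^ 2 - a ^ 2)) (b ^ 2 * (c ^ 2 + a ^ 2 - b ^ 2))
      (c ^ 2 * (a ^ 2 + b ^ 2 - c ^ 2)) = 0 := by
  have hA : b ^ 2 + c ^ 2 - a ^ 2 = 2 * b * c * cosA := by rw [hcosA]; field_simp
  have hB : c ^ 2 + a ^ 2 - b ^ 2 = 2 * c * a * cosB := by rw [hcosB]; field_simp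
  have hC : a ^ 2 + b ^ 2 - c ^ 2 = 2 * a * b * cosC := by rw [hcosC]; field_simp
  rw [hF, hA, hB, hC]
  ring
end

section
/- Let A, B, C be an affinely independent triple of points in EuclideanSpace ℝ (Fin 2), let a = dist B C, b = dist C A, c = dist A B, set cosA = (b² + c² − a²)/(2bc), cosB = (c² + a² − b²)/(2ca), cosC = (a² + b² − c²)/(2ab), and define F(x, y, z) = a·x·(b²z² − c²y²)·(cosA − cosB·cosC) + b·y·(c²x² − a²z²)·(cosB − cosA·cosC) + c·z·(a²y² − b²x²)·(cosC − cosA·cosB). Let P be the point with barycentric coordinates (α, β, γ) (so α + β + γ = 1 and P = α • A + β • B + γ • C), and let A₁, B₁, C₁ be the orthogonal projections of P onto the lines BC, CA, AB respectively. Assume A₁ ∉ {B, C}, B₁ ∉ {C, A}, C₁ ∉ {A, B}, and F(α, β, γ) = 0. If a point X lies on the line through A and A₁ and on the line through B and B₁, and X does not lie on the line through A and B, then X also lies on the line through C and C₁; i.e., the three cevian lines A A₁, B B₁, C C₁ are concurrent. -/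
open EuclideanGeometry

/-- Position of the orthogonal projection of `α • A + β • B + γ • C` along the line `BC`. -/
lemma exists_orthogonalProjection_eq_lineMap
    {A B C P : EuclideanSpace ℝ (Fin 2)} {α β γ : ℝ} (hsum : α + β + γ = 1)
    (hP : P = α • A + β • B + γ • C) :
    ∃ t : ℝ, (EuclideanGeometry.orthogonalProjection (affineSpan ℝ {B, C}) P :
        EuclideanSpace ℝ (Fin 2)) = AffineMap.lineMap B C t ∧
      t * dist B C ^ 2 =
        α * ((dist A B ^ 2 + dist B C ^ 2 - dist C A ^ 2) / 2) + γ * dist B C ^ 2 := by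
  obtain ⟨t, ht⟩ := mem_affineSpan_pair_iff_exists_lineMap_eq.1
    (EuclideanGeometry.orthogonalProjection_mem (s := affineSpan ℝ {B, C}) P)
  refine ⟨t, ht.symm, ?_⟩
  have hperp : inner ℝ (C - B) (P - AffineMap.lineMap B C t) = 0 := by
    rw [ht]
    exact EuclideanGeometry.vsub_orthogonalProjection_mem_direction_orthogonal
      (affineSpan ℝ {B, C}) P _
      (AffineSubspace.vsub_mem_direction (right_mem_affineSpan_pair ℝ B C)
        (left_mem_affineSpan_pair ℝ B C))
  have hdecomp : P - AffineMap.lineMap B C t = α • (A - B) + (γ - t) • (C - B) := by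
    rw [hP, AffineMap.lineMap_apply, vsub_eq_sub, vadd_eq_add]
    obtain rfl : β = 1 - α - γ := by linarith
    module
  have hCA : dist C A ^ 2 = dist B C ^ 2 - 2 * inner ℝ (C - B) (A - B) + dist A B ^ 2 := by
    rw [dist_comm B C, dist_eq_norm, dist_eq_norm, dist_eq_norm, ← norm_sub_sq_real]
    congr 2
    abel
  rw [hdecomp, inner_add_right, inner_smul_right, inner_smul_right, real_inner_self_eq_norm_sq,
    ← dist_eq_norm, dist_comm C B] at hperp
  linear_combination -hperp + α / 2 * hCA

/-- The edge vectors of a nondegenerate triangle `ABC` at `A` are linearly independent. -/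
lemma AffineIndependent.coeff_eq_zero_of_smul_sub_add_smul_sub_eq_zero
    {A B C : EuclideanSpace ℝ (Fin 2)} (hABC : AffineIndependent ℝ ![A, B, C])
    {y z : ℝ} (h : y • (B - A) + z • (C - A) = 0) : y = 0 ∧ z = 0 := by
  have hw := affineIndependent_iff.1 hABC Finset.univ ![-y - z, y, z]
    (by simp only [Fin.sum_univ_three, Matrix.cons_val]; ring) (by
      simp only [Fin.sum_univ_three, Matrix.cons_val]
      rw [← h]
      module)
  exact ⟨hw 1 (Finset.mem_univ _), hw 2 (Finset.mem_univ _)⟩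

/-- Ceva's theorem: if `t s r = (1 - t) (1 - s) (1 - r)`, the three cevians are concurrent. -/
lemma mem_affineSpan_pair_of_ceva
    {A B C X : EuclideanSpace ℝ (Fin 2)} (hABC : AffineIndependent ℝ ![A, B, C])
    {t s r : ℝ} (hs : s ≠ 1) (hceva : t * s * r = (1 - t) * (1 - s) * (1 - r))
    (hXA : X ∈ affineSpan ℝ {A, AffineMap.lineMap B C t})
    (hXB : X ∈ affineSpan ℝ {B, AffineMap.lineMap C A s}) :
    X ∈ affineSpan ℝ {C, AffineMap.lineMap A B r} := by
  obtain ⟨m, hm⟩ := mem_affineSpan_pair_iff_exists_lineMap_eq.1 hXA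
  obtain ⟨n, hn⟩ := mem_affineSpan_pair_iff_exists_lineMap_eq.1 hXB
  simp only [AffineMap.lineMap_apply, vsub_eq_sub, vadd_eq_add] at hm hn
  obtain ⟨hy, hz⟩ := hABC.coeff_eq_zero_of_smul_sub_add_smul_sub_eq_zero
    (y := m * (1 - t) - (1 - n)) (z := m * t - n * (1 - s)) (by
      rw [← sub_eq_zero_of_eq (hm.trans hn.symm)]
      module)
  have hs' : 1 - s ≠ 0 := sub_ne_zero.2 hs.symm
  have hratio : (1 - m) * r = m * (1 - t) * (1 - r) := by
    apply mul_left_cancel₀ hs'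
    linear_combination (-(1 - s) * r) * hy - r * hz + m * hceva
  refine mem_affineSpan_pair_iff_exists_lineMap_eq.2 ⟨1 - m * t, ?_⟩
  rw [← hm]
  simp only [AffineMap.lineMap_apply, vsub_eq_sub, vadd_eq_add]
  have hr : (1 - m * t) * r = m * (1 - t) := by linear_combination hratio
  rw [← sub_eq_zero]
  trans ((1 - m * t) * r - m * (1 - t)) • (B - A)
  · module
  · rw [hr, sub_self, zero_smul]

theorem locus_implies_cevians_concurrent
    (A B C P : EuclideanSpace ℝ (Fin 2))
    (hABC : AffineIndependent ℝ ![A, B, C])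
    (a b c cosA cosB cosC α β γ : ℝ)
    (ha : a = dist B C) (hb : b = dist C A) (hc : c = dist A B)
    (hcosA : cosA = (b ^ 2 + c ^ 2 - a ^ 2) / (2 * b * c))
    (hcosB : cosB = (c ^ 2 + a ^ 2 - b ^ 2) / (2 * c * a))
    (hcosC : cosC = (a ^ 2 + b ^ 2 - c ^ 2) / (2 * a * b))
    (F : ℝ → ℝ → ℝ → ℝ)
    (hF : ∀ x y z : ℝ, F x y z =
      a * x * (b ^ 2 * z ^ 2 - c ^ 2 * y ^ 2) * (cosA - cosB * cosC) +
        b * y * (c ^ 2 * x ^ 2 - a ^ 2 * z ^ 2) * (cosB - cosA * cosC) +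
        c * z * (a ^ 2 * y ^ 2 - b ^ 2 * x ^ 2) * (cosC - cosA * cosB))
    (hsum : α + β + γ = 1)
    (hP : P = α • A + β • B + γ • C)
    (A₁ B₁ C₁ : EuclideanSpace ℝ (Fin 2))
    (hA₁ : A₁ = (EuclideanGeometry.orthogonalProjection (affineSpan ℝ {B, C}) P :
        EuclideanSpace ℝ (Fin 2)))
    (hB₁ : B₁ = (EuclideanGeometry.orthogonalProjection (affineSpan ℝ {C, A}) P :
        EuclideanSpace ℝ (Fin 2)))
    (hC₁ : C₁ = (EuclideanGeometry.orthogonalProjection (affineSpan ℝ {A, B}) P :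
        EuclideanSpace ℝ (Fin 2)))
    (hA₁B : A₁ ≠ B) (hA₁C : A₁ ≠ C)
    (hB₁C : B₁ ≠ C) (hB₁A : B₁ ≠ A)
    (hC₁A : C₁ ≠ A) (hC₁B : C₁ ≠ B)
    (hloc : F α β γ = 0)
    (X : EuclideanSpace ℝ (Fin 2))
    (hXA : X ∈ affineSpan ℝ {A, A₁})
    (hXB : X ∈ affineSpan ℝ {B, B₁})
    (hXAB : X ∉ affineSpan ℝ {A, B}) :
    X ∈ affineSpan ℝ {C, C₁} := by
  have hAB : A ≠ B := hABC.injective.ne (by decide : (0 : Fin 3) ≠ 1)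
  have hBC : B ≠ C := hABC.injective.ne (by decide : (1 : Fin 3) ≠ 2)
  have hCA : C ≠ A := hABC.injective.ne (by decide : (2 : Fin 3) ≠ 0)
  obtain ⟨t, ht, hta⟩ := exists_orthogonalProjection_eq_lineMap hsum hP
  obtain ⟨s, hs, hsb⟩ := exists_orthogonalProjection_eq_lineMap (A := B) (B := C) (C := A)
    (α := β) (β := γ) (γ := α) (P := P) (by linarith) (by rw [hP]; abel)
  obtain ⟨r, hr, hrc⟩ := exists_orthogonalProjection_eq_lineMap (A := C) (B := A) (C := B)
    (α := γ) (β := α) (γ := β) (P := P) (by linarith) (by rw [hP]; abel)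
  have ha0 : a ≠ 0 := ha ▸ dist_ne_zero.2 hBC
  have hb0 : b ≠ 0 := hb ▸ dist_ne_zero.2 hCA
  have hc0 : c ≠ 0 := hc ▸ dist_ne_zero.2 hAB
  rw [← ha, ← hb, ← hc] at hta hsb hrc
  have hs1 : s ≠ 1 := by
    rintro rfl
    exact hB₁A (by rw [hB₁, hs, AffineMap.lineMap_apply_one])
  rw [hA₁, ht] at hXA
  rw [hB₁, hs] at hXB
  rw [hC₁, hr]
  refine mem_affineSpan_pair_of_ceva hABC hs1 ?_ hXA hXB
  obtain rfl := eq_div_of_mul_eq (pow_ne_zero 2 ha0) hta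
  obtain rfl := eq_div_of_mul_eq (pow_ne_zero 2 hb0) hsb
  obtain rfl := eq_div_of_mul_eq (pow_ne_zero 2 hc0) hrc
  rw [hF, hcosA, hcosB, hcosC] at hloc
  obtain rfl : β = 1 - α - γ := by linarith
  rw [← sub_eq_zero]
  refine Eq.trans ?_ (mul_eq_zero_of_right (1 / (a * b * c)) hloc)
  field_simp
  ring
end

section
/- Let A, B, C be an affinely independent triple of points in EuclideanSpace ℝ (Fin 2), let a = dist B C, b = dist C A, c = dist A B, set cosA = (b² + c² − a²)/(2bc), cosB = (c² + a² − b²)/(2ca), cosC = (a² + b² − c²)/(2ab), and define F(x, y, z) = a·x·(b²z² − c²y²)·(cosA − cosB·cosC) + b·y·(c²x² − a²z²)·(cosB − cosA·cosC) + c·z·(a²y² − b²x²)·(cosC − cosA·cosB). Let P be the point with barycentric coordinates (α, β, γ) (so α + β + γ = 1 and P = α • A + β • B + γ • C), and let A₁, B₁, C₁ be the orthogonal projections of P onto the lines BC, CA, AB respectively. Assume A₁ ∉ {B, C}, B₁ ∉ {C, A}, C₁ ∉ {A, B}. If there exists a point X lying on all three lines A A₁, B B₁, C C₁ and X does not lie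 on any of the lines BC, CA, AB, then F(α, β, γ) = 0. -/
open EuclideanGeometry

section Barycentric

variable {V : Type*} [NormedAddCommGroup V] [InnerProductSpace ℝ V]

/-- Barycentric coordinates with respect to an affinely independent triple are unique. -/
lemma AffineIndependent.barycentric_unique {A B C : V} (h : AffineIndependent ℝ ![A, B, C])
    {x y z x' y' z' : ℝ} (hsum : x + y + z = 1) (hsum' : x' + y' + z' = 1)
    (heq : x • A + y • B + z • C = x' • A + y' • B + z' • C) :
    x = x' ∧ y = y' ∧ z = z' := by
  have key := (affineIndependent_iff.mp h) Finset.univ ![x - x', y - y', z - z']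
    (by simp [Fin.sum_univ_three]; linarith)
    (by
      simp only [Fin.sum_univ_three, Matrix.cons_val]
      linear_combination (norm := module) heq)
  have h0 := key 0 (Finset.mem_univ _)
  have h1 := key 1 (Finset.mem_univ _)
  have h2 := key 2 (Finset.mem_univ _)
  simp only [Matrix.cons_val] at h0 h1 h2
  exact ⟨by linarith, by linarith, by linarith⟩

/-- Barycentric coordinates of the points of a line through a vertex and a point of the
opposite side. -/
lemma exists_barycentric_of_mem_cevian {A B C D X : V} (hD : D ∈ affineSpan ℝ {B, C})
    (hX : X ∈ affineSpan ℝ {A, D}) :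
    ∃ x y z : ℝ, x + y + z = 1 ∧ X = x • A + y • B + z • C := by
  obtain ⟨t, rfl⟩ := mem_affineSpan_pair_iff_exists_lineMap_eq.mp hD
  obtain ⟨s, rfl⟩ := mem_affineSpan_pair_iff_exists_lineMap_eq.mp hX
  refine ⟨1 - s, s * (1 - t), s * t, by ring, ?_⟩
  simp only [AffineMap.lineMap_apply_module]
  module

/-- The cevian through the orthogonal projection of `P` onto the opposite side, as a linear
equation in barycentric coordinates. -/
lemma cevian_orthogonalProjection_equation {A B C P X : V}
    (h : AffineIndependent ℝ ![A, B, C]) {α β γ x y z : ℝ}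
    (hsum : α + β + γ = 1) (hP : P = α • A + β • B + γ • C)
    (hxyz : x + y + z = 1) (hX : X = x • A + y • B + z • C)
    (hXA : X ∈ affineSpan ℝ
      {A, (EuclideanGeometry.orthogonalProjection (affineSpan ℝ {B, C}) P : V)}) :
    y * (2 * dist B C ^ 2 * γ + α * (dist A B ^ 2 + dist B C ^ 2 - dist C A ^ 2)) =
      z * (2 * dist B C ^ 2 * β + α * (dist B C ^ 2 + dist C A ^ 2 - dist A B ^ 2)) := by
  have hmem := EuclideanGeometry.orthogonalProjection_mem (s := affineSpan ℝ {B, C}) P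
  have horth : inner ℝ (C - B)
      (P - (EuclideanGeometry.orthogonalProjection (affineSpan ℝ {B, C}) P : V)) = 0 :=
    EuclideanGeometry.vsub_orthogonalProjection_mem_direction_orthogonal (affineSpan ℝ {B, C}) P
      (C - B) (AffineSubspace.vsub_mem_direction (right_mem_affineSpan_pair ℝ B C)
        (left_mem_affineSpan_pair ℝ B C))
  generalize (EuclideanGeometry.orthogonalProjection (affineSpan ℝ {B, C}) P : V) = D at *
  obtain ⟨t, rfl⟩ := mem_affineSpan_pair_iff_exists_lineMap_eq.mp hmem
  obtain ⟨s, hs⟩ := mem_affineSpan_pair_iff_exists_lineMap_eq.mp hXA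
  obtain ⟨-, rfl, rfl⟩ := h.barycentric_unique (x' := 1 - s) (y' := s * (1 - t)) (z' := s * t)
    hxyz (by ring) (by
      rw [← hX, ← hs]
      simp only [AffineMap.lineMap_apply_module]
      module)
  have hdiff : P - AffineMap.lineMap B C t = α • (A - B) + (γ - t) • (C - B) := by
    obtain rfl : β = 1 - α - γ := by linarith
    rw [hP, AffineMap.lineMap_apply_module]
    module
  rw [hdiff, inner_add_right, inner_smul_right, inner_smul_right,
    real_inner_self_eq_norm_sq, real_inner_comm] at horth
  have hcos := norm_sub_sq_real (A - B) (C - B)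
  rw [sub_sub_sub_cancel_right] at hcos
  rw [dist_eq_norm A B, dist_comm B C, dist_eq_norm C B, dist_comm C A, dist_eq_norm A C]
  obtain rfl : β = 1 - α - γ := by linarith
  linear_combination 2 * s * horth - α * s * hcos

end Barycentric

theorem cevians_concurrent_implies_locus
    (A B C P : EuclideanSpace ℝ (Fin 2))
    (hABC : AffineIndependent ℝ ![A, B, C])
    (a b c cosA cosB cosC α β γ : ℝ)
    (ha : a = dist B C) (hb : b = dist C A) (hc : c = dist A B)
    (hcosA : cosA = (b ^ 2 + c ^ 2 - a ^ 2) / (2 * b * c))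
    (hcosB : cosB = (c ^ 2 + a ^ 2 - b ^ 2) / (2 * c * a))
    (hcosC : cosC = (a ^ 2 + b ^ 2 - c ^ 2) / (2 * a * b))
    (F : ℝ → ℝ → ℝ → ℝ)
    (hF : ∀ x y z : ℝ, F x y z =
      a * x * (b ^ 2 * z ^ 2 - c ^ 2 * y ^ 2) * (cosA - cosB * cosC) +
        b * y * (c ^ 2 * x ^ 2 - a ^ 2 * z ^ 2) * (cosB - cosA * cosC) +
        c * z * (a ^ 2 * y ^ 2 - b ^ 2 * x ^ 2) * (cosC - cosA * cosB))
    (hsum : α + β + γ = 1)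
    (hP : P = α • A + β • B + γ • C)
    (A₁ B₁ C₁ : EuclideanSpace ℝ (Fin 2))
    (hA₁ : A₁ = (EuclideanGeometry.orthogonalProjection (affineSpan ℝ {B, C}) P :
        EuclideanSpace ℝ (Fin 2)))
    (hB₁ : B₁ = (EuclideanGeometry.orthogonalProjection (affineSpan ℝ {C, A}) P :
        EuclideanSpace ℝ (Fin 2)))
    (hC₁ : C₁ = (EuclideanGeometry.orthogonalProjection (affineSpan ℝ {A, B}) P :
        EuclideanSpace ℝ (Fin 2)))
    (hA₁B : A₁ ≠ B) (hA₁C : A₁ ≠ C)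
    (hB₁C : B₁ ≠ C) (hB₁A : B₁ ≠ A)
    (hC₁A : C₁ ≠ A) (hC₁B : C₁ ≠ B)
    (X : EuclideanSpace ℝ (Fin 2))
    (hXA : X ∈ affineSpan ℝ {A, A₁})
    (hXB : X ∈ affineSpan ℝ {B, B₁})
    (hXC : X ∈ affineSpan ℝ {C, C₁})
    (hXBC : X ∉ affineSpan ℝ {B, C})
    (hXCA : X ∉ affineSpan ℝ {C, A})
    (hXAB : X ∉ affineSpan ℝ {A, B}) :
    F α β γ = 0 := by
  obtain ⟨x, y, z, hxyz, hX⟩ := exists_barycentric_of_mem_cevian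
    (hA₁ ▸ EuclideanGeometry.orthogonalProjection_mem P) hXA
  have hx : x ≠ 0 := by
    rintro rfl
    refine hXBC (mem_affineSpan_pair_iff_exists_lineMap_eq.mpr ⟨z, ?_⟩)
    obtain rfl : y = 1 - z := by linarith
    rw [hX, AffineMap.lineMap_apply_module]
    module
  have hy : y ≠ 0 := by
    rintro rfl
    refine hXCA (mem_affineSpan_pair_iff_exists_lineMap_eq.mpr ⟨x, ?_⟩)
    obtain rfl : z = 1 - x := by linarith
    rw [hX, AffineMap.lineMap_apply_module]
    module
  have hz : z ≠ 0 := by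
    rintro rfl
    refine hXAB (mem_affineSpan_pair_iff_exists_lineMap_eq.mpr ⟨y, ?_⟩)
    obtain rfl : x = 1 - y := by linarith
    rw [hX, AffineMap.lineMap_apply_module]
    module
  have hBCA : AffineIndependent ℝ ![B, C, A] := by
    convert hABC.comp_embedding (finRotate 3).toEmbedding using 1
    ext i : 1
    fin_cases i <;> rfl
  have hCAB : AffineIndependent ℝ ![C, A, B] := by
    convert hBCA.comp_embedding (finRotate 3).toEmbedding using 1
    ext i : 1
    fin_cases i <;> rfl
  have e₁ := cevian_orthogonalProjection_equation hABC hsum hP hxyz hX (hA₁ ▸ hXA)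
  have e₂ := cevian_orthogonalProjection_equation hBCA (P := P) (X := X)
    (α := β) (β := γ) (γ := α) (x := y) (y := z) (z := x)
    (by linarith) (by rw [hP]; abel) (by linarith) (by rw [hX]; abel) (hB₁ ▸ hXB)
  have e₃ := cevian_orthogonalProjection_equation hCAB (P := P) (X := X)
    (α := γ) (β := α) (γ := β) (x := z) (y := x) (z := y)
    (by linarith) (by rw [hP]; abel) (by linarith) (by rw [hX]; abel) (hC₁ ▸ hXC)
  have ha0 : a ≠ 0 := ha ▸ dist_ne_zero.mpr (hABC.injective.ne (by decide : (1 : Fin 3) ≠ 2))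
  have hb0 : b ≠ 0 := hb ▸ dist_ne_zero.mpr (hABC.injective.ne (by decide : (2 : Fin 3) ≠ 0))
  have hc0 : c ≠ 0 := hc ▸ dist_ne_zero.mpr (hABC.injective.ne (by decide : (0 : Fin 3) ≠ 1))
  rw [← ha, ← hb, ← hc] at e₁ e₂ e₃
  have ceva := congr_arg₂ (· * ·) (congr_arg₂ (· * ·) e₁ e₂) e₃
  have ceva' := mul_left_cancel₀ (mul_ne_zero (mul_ne_zero hx hy) hz) (a := x * y * z)
    (b := (2 * a ^ 2 * γ + α * (c ^ 2 + a ^ 2 - b ^ 2)) *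
      (2 * b ^ 2 * α + β * (a ^ 2 + b ^ 2 - c ^ 2)) *
      (2 * c ^ 2 * β + γ * (b ^ 2 + c ^ 2 - a ^ 2)))
    (c := (2 * a ^ 2 * β + α * (a ^ 2 + b ^ 2 - c ^ 2)) *
      (2 * b ^ 2 * γ + β * (b ^ 2 + c ^ 2 - a ^ 2)) *
      (2 * c ^ 2 * α + γ * (c ^ 2 + a ^ 2 - b ^ 2)))
    (by linear_combination ceva)
  rw [hF, hcosA, hcosB, hcosC]
  field_simp
  linear_combination (1 / 2) * ceva'
end
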